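/- For the first Bessel function of the first kind J₁, for all x ≥ 1 one has |J₁(x)| < 1/√x. -/

import Mathlib

/-- The Bessel function of the first kind of order 1, defined by its power series
`J₁(x) = Σ_{m=0}^∞ (−1)^m / (m!·(m+1)!) · (x/2)^{2m+1}`. -/
noncomputable def besselJ1 (x : ℝ) : ℝ :=
  ∑' m : ℕ, (-1 : ℝ) ^ m / ((Nat.factorial m : ℝ) * (Nat.factorial (m + 1) : ℝ)) *
    (x / 2) ^ (2 * m + 1)

theorem summable_mul_pow_of_abs_le {a : ℕ → ℝ} (ha : ∀ m, |a m| ≤ 1 / (m.factorial : ℝ))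
    (y : ℝ) : Summable fun m => a m * y ^ m :=
  Summable.of_norm_bounded (Real.summable_pow_div_factorial |y|) fun m => by
    rw [Real.norm_eq_abs, abs_mul, abs_pow, div_eq_mul_one_div, mul_comm]
    gcongr
    exact ha m

/-- Termwise differentiation of an everywhere convergent power series whose coefficients are
dominated by those of the exponential series. -/
theorem hasDerivAt_tsum_mul_pow {a : ℕ → ℝ} (ha : ∀ m, |a m| ≤ 1 / (m.factorial : ℝ)) (z : ℝ) :
    HasDerivAt (fun y : ℝ => ∑' m, a m * y ^ m) (∑' m : ℕ, (m + 1) * a (m + 1) * z ^ m) z := by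
  set R : ℝ := |z| + 1 with hR
  have hR0 : 0 ≤ R := by positivity
  have hsum : ∀ y : ℝ, Summable fun m => a m * y ^ m :=
    summable_mul_pow_of_abs_le ha
  have hterm : ∀ (m : ℕ) (y : ℝ), |y| ≤ R →
      ‖((m + 1 : ℕ) : ℝ) * a (m + 1) * y ^ m‖ ≤ R ^ m / (m.factorial : ℝ) := fun m y hy => by
    have h1 := ha (m + 1)
    rw [Nat.factorial_succ] at h1
    rw [Real.norm_eq_abs, abs_mul, abs_mul, abs_pow, Nat.abs_cast]
    calc ((m + 1 : ℕ) : ℝ) * |a (m + 1)| * |y| ^ m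
        ≤ ((m + 1 : ℕ) : ℝ) * (1 / (((m + 1) * m.factorial : ℕ) : ℝ)) * R ^ m := by gcongr
      _ = R ^ m / (m.factorial : ℝ) := by
        have : (m.factorial : ℝ) ≠ 0 := by positivity
        push_cast
        field_simp
  have hshift : (fun y : ℝ => ∑' m, a m * y ^ m)
      = fun y => a 0 + ∑' m, a (m + 1) * y ^ (m + 1) := by
    funext y
    rw [(hsum y).tsum_eq_zero_add]
    simp
  have hz : z ∈ Metric.ball (0 : ℝ) R := by simp [hR]
  have key := hasDerivAt_tsum_of_isPreconnected
    (g := fun (m : ℕ) (y : ℝ) => a (m + 1) * y ^ (m + 1))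
    (g' := fun (m : ℕ) (y : ℝ) => ((m + 1 : ℕ) : ℝ) * a (m + 1) * y ^ m)
    (Real.summable_pow_div_factorial R) Metric.isOpen_ball
    (convex_ball (0 : ℝ) R).isPreconnected
    (fun m y _ => by
      refine ((hasDerivAt_pow (m + 1) y).const_mul (a (m + 1))).congr_deriv ?_
      rw [Nat.add_sub_cancel]
      ring)
    (fun m y hy => hterm m y (by simpa using (Metric.mem_ball.1 hy).le))
    hz ((summable_nat_add_iff 1).2 (hsum z)) hz
  rw [hshift]
  simpa using key.const_add (a 0)

/-- The power series `∑ (-1)^m z^m / (m! (m+k)!)`, which satisfies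
`J_k(x) = (x/2)^k * besselSeries k (x^2/4)`. -/
noncomputable def besselSeries (k : ℕ) (z : ℝ) : ℝ :=
  ∑' m : ℕ, (-1 : ℝ) ^ m / ((m.factorial : ℝ) * ((m + k).factorial : ℝ)) * z ^ m

theorem besselJ1_eq (x : ℝ) : besselJ1 x = x / 2 * besselSeries 1 (x ^ 2 / 4) := by
  rw [besselJ1, besselSeries, ← tsum_mul_left]
  refine tsum_congr fun m => ?_
  rw [pow_succ, pow_mul]
  ring

theorem one_div_factorial_mul_le (m n : ℕ) :
    1 / ((m.factorial : ℝ) * (n.factorial : ℝ)) ≤ 1 / (m.factorial : ℝ) := by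
  have h : (1 : ℝ) ≤ n.factorial := by exact_mod_cast n.factorial_pos
  have h' : (0 : ℝ) < m.factorial := by exact_mod_cast m.factorial_pos
  exact one_div_le_one_div_of_le h' (by nlinarith)

theorem abs_besselSeries_coeff_le (k m : ℕ) :
    |(-1 : ℝ) ^ m / ((m.factorial : ℝ) * ((m + k).factorial : ℝ))| ≤ 1 / (m.factorial : ℝ) := by
  rw [abs_div, abs_pow, abs_neg, abs_one, one_pow, abs_of_pos (by positivity)]
  exact one_div_factorial_mul_le m (m + k)

theorem hasDerivAt_besselSeries_zero (z : ℝ) :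
    HasDerivAt (besselSeries 0) (-besselSeries 1 z) z := by
  refine (hasDerivAt_tsum_mul_pow (abs_besselSeries_coeff_le 0) z).congr_deriv ?_
  rw [besselSeries, ← tsum_neg]
  refine tsum_congr fun m => ?_
  have : (m.factorial : ℝ) ≠ 0 := by positivity
  simp only [add_zero, Nat.factorial_succ, pow_succ]
  push_cast
  field_simp

theorem hasDerivAt_mul_besselSeries_one (z : ℝ) :
    HasDerivAt (fun y => y * besselSeries 1 y) (besselSeries 0 z) z := by
  let a : ℕ → ℝ := fun m => m * ((-1 : ℝ) ^ (m - 1) / ((m.factorial : ℝ) * (m.factorial : ℝ)))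
  have ha : ∀ m, |a m| ≤ 1 / (m.factorial : ℝ) := by
    rintro (_ | m)
    · simp [a]
    · have h := one_div_factorial_mul_le (m + 1) m
      have h0 : (m.factorial : ℝ) ≠ 0 := by positivity
      convert h using 1
      simp only [a, Nat.add_sub_cancel, abs_mul, abs_div, abs_pow, abs_neg, abs_one, one_pow,
        Nat.abs_cast, Nat.factorial_succ]
      push_cast
      field_simp
  convert hasDerivAt_tsum_mul_pow ha z using 1
  · funext y
    rw [(summable_mul_pow_of_abs_le ha y).tsum_eq_zero_add, besselSeries, ← tsum_mul_left]
    simp only [a, Nat.cast_zero, zero_mul, zero_add]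
    refine tsum_congr fun m => ?_
    have h0 : (m.factorial : ℝ) ≠ 0 := by positivity
    simp only [Nat.add_sub_cancel, Nat.factorial_succ, pow_succ]
    push_cast
    field_simp
  · rw [besselSeries]
    refine tsum_congr fun m => ?_
    have h0 : (m.factorial : ℝ) ≠ 0 := by positivity
    simp only [a, add_zero, Nat.add_sub_cancel, Nat.factorial_succ]
    push_cast
    field_simp

theorem hasDerivAt_besselSeries_zero_comp (x : ℝ) :
    HasDerivAt (fun y : ℝ => besselSeries 0 (y ^ 2 / 4)) (-besselJ1 x) x := by
  have h : HasDerivAt (fun y : ℝ => y ^ 2 / 4) (x / 2) x := by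
    refine ((hasDerivAt_pow 2 x).div_const 4).congr_deriv ?_
    push_cast
    ring
  refine ((hasDerivAt_besselSeries_zero (x ^ 2 / 4)).comp x h).congr_deriv ?_
  rw [besselJ1_eq]
  ring

theorem hasDerivAt_besselJ1 {x : ℝ} (hx : x ≠ 0) :
    HasDerivAt besselJ1 (besselSeries 0 (x ^ 2 / 4) - besselJ1 x / x) x := by
  have h : HasDerivAt (fun y : ℝ => y ^ 2 / 4) (x / 2) x := by
    refine ((hasDerivAt_pow 2 x).div_const 4).congr_deriv ?_
    push_cast
    ring
  have h1 := ((hasDerivAt_mul_besselSeries_one (x ^ 2 / 4)).comp x h).const_mul 2 |>.div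
    (hasDerivAt_id x) hx
  have h2 : HasDerivAt besselJ1 _ x := h1.congr_of_eventuallyEq (by
    filter_upwards [isOpen_ne.mem_nhds hx] with y hy
    have hy' : y ≠ 0 := hy
    rw [besselJ1_eq]
    simp only [Pi.div_apply, Function.comp_apply, id]
    field_simp
    norm_num)
  refine h2.congr_deriv ?_
  rw [besselJ1_eq]
  simp only [Function.comp_apply, id]
  field_simp
  ring

/-- The partial sums of even and odd length enclose the series for arguments in `[0, 1]`. -/
theorem besselSeries_mem_Icc (k n : ℕ) {z : ℝ} (h0 : 0 ≤ z) (h1 : z ≤ 1) :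
    besselSeries k z ∈ Set.Icc
      (∑ i ∈ Finset.range (2 * n), (-1 : ℝ) ^ i *
        (z ^ i / ((i.factorial : ℝ) * ((i + k).factorial : ℝ))))
      (∑ i ∈ Finset.range (2 * n + 1), (-1 : ℝ) ^ i *
        (z ^ i / ((i.factorial : ℝ) * ((i + k).factorial : ℝ)))) := by
  have ht := (summable_mul_pow_of_abs_le (abs_besselSeries_coeff_le k) z).hasSum.tendsto_sum_nat
  simp only [div_mul_eq_mul_div, mul_div_assoc] at ht
  have hanti : Antitone fun i : ℕ =>
      z ^ i / ((i.factorial : ℝ) * ((i + k).factorial : ℝ)) := by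
    intro i j hij
    exact div_le_div₀ (by positivity) (pow_le_pow_of_le_one h0 h1 hij) (by positivity)
      (by exact_mod_cast Nat.mul_le_mul (Nat.factorial_le hij) (Nat.factorial_le (by omega)))
  have hB : besselSeries k z = ∑' m : ℕ, (-1 : ℝ) ^ m *
      (z ^ m / ((m.factorial : ℝ) * ((m + k).factorial : ℝ))) := by
    simp only [besselSeries, div_mul_eq_mul_div, mul_div_assoc]
  rw [hB]
  exact ⟨hanti.alternating_series_le_tendsto ht n, hanti.tendsto_le_alternating_series ht n⟩

/-- Sonin's function for `√x J₁(x)`, which solves `u'' + (1 - 3 / (4 x²)) u = 0`. -/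
noncomputable def soninJ1 (x : ℝ) : ℝ :=
  x * besselJ1 x ^ 2 +
    x * (x * besselSeries 0 (x ^ 2 / 4) - besselJ1 x / 2) ^ 2 / (x ^ 2 - 3 / 4)

theorem hasDerivAt_soninJ1 {x : ℝ} (hx : 1 ≤ x) :
    HasDerivAt soninJ1 (-(3 / 2) *
      (x * besselSeries 0 (x ^ 2 / 4) - besselJ1 x / 2) ^ 2 / (x ^ 2 - 3 / 4) ^ 2) x := by
  have hx0 : x ≠ 0 := by positivity
  have hs : x ^ 2 - 3 / 4 ≠ 0 := by nlinarith
  have hJ := hasDerivAt_besselJ1 hx0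
  have hw := ((hasDerivAt_id x).mul (hasDerivAt_besselSeries_zero_comp x)).sub (hJ.div_const 2)
  have h := ((hasDerivAt_id x).mul (hJ.pow 2)).add
    (((hasDerivAt_id x).mul (hw.pow 2)).div ((hasDerivAt_pow 2 x).sub_const (3 / 4)) hs)
  refine h.congr_deriv ?_
  simp only [id, Pi.mul_apply, Pi.sub_apply, Pi.pow_apply]
  generalize besselSeries 0 (x ^ 2 / 4) = b
  generalize besselJ1 x = j
  have hs' : x ^ 2 * 4 - 3 ≠ 0 := by nlinarith
  field_simp
  ring

theorem antitoneOn_soninJ1 : AntitoneOn soninJ1 (Set.Ici 1) := by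
  refine antitoneOn_of_deriv_nonpos (convex_Ici 1)
    (fun x hx => (hasDerivAt_soninJ1 hx).continuousAt.continuousWithinAt)
    (fun x hx => ?_) (fun x hx => ?_) <;> rw [interior_Ici] at hx
  · exact (hasDerivAt_soninJ1 (le_of_lt hx)).differentiableAt.differentiableWithinAt
  · rw [(hasDerivAt_soninJ1 (le_of_lt hx)).deriv]
    exact div_nonpos_of_nonpos_of_nonneg
      (mul_nonpos_of_nonpos_of_nonneg (by norm_num) (sq_nonneg _)) (sq_nonneg _)

theorem soninJ1_three_halves_lt : soninJ1 (3 / 2) < 1 := by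
  obtain ⟨h1, h2⟩ := besselSeries_mem_Icc 0 1 (z := 9 / 16) (by norm_num) (by norm_num)
  obtain ⟨h3, -⟩ := besselSeries_mem_Icc 1 1 (z := 9 / 16) (by norm_num) (by norm_num)
  obtain ⟨-, h4⟩ := besselSeries_mem_Icc 1 1 (z := 9 / 16) (by norm_num) (by norm_num)
  norm_num [Finset.sum_range_succ, Nat.factorial] at h1 h2 h3 h4
  rw [soninJ1, besselJ1_eq (3 / 2), show ((3 / 2 : ℝ)) ^ 2 / 4 = 9 / 16 by norm_num]
  norm_num
  generalize besselSeries 0 (9 / 16) = b at *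
  generalize besselSeries 1 (9 / 16) = c at *
  have hc : c ^ 2 ≤ (3 / 4) ^ 2 := by
    apply pow_le_pow_left₀ <;> linarith
  have hw : (3 / 2 * b - 3 / 4 * c / 2) ^ 2 ≤ (6 / 10) ^ 2 := by
    apply pow_le_pow_left₀ <;> linarith
  nlinarith

theorem mul_besselJ1_sq_lt_one {x : ℝ} (hx : 1 ≤ x) : x * besselJ1 x ^ 2 < 1 := by
  rcases le_total x (3 / 2) with h | h
  · obtain ⟨h1, -⟩ := besselSeries_mem_Icc 1 1 (z := x ^ 2 / 4) (by positivity) (by nlinarith)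
    obtain ⟨-, h2⟩ := besselSeries_mem_Icc 1 0 (z := x ^ 2 / 4) (by positivity) (by nlinarith)
    norm_num [Finset.sum_range_succ, Nat.factorial] at h1 h2
    have hf : 0 ≤ besselSeries 1 (x ^ 2 / 4) := by nlinarith
    have hJ0 : 0 ≤ besselJ1 x := by rw [besselJ1_eq]; positivity
    have hJ : besselJ1 x ≤ 3 / 4 := by rw [besselJ1_eq]; nlinarith
    calc x * besselJ1 x ^ 2 ≤ 3 / 2 * (3 / 4) ^ 2 := by gcongr
      _ < 1 := by norm_num
  · have hle := antitoneOn_soninJ1 (Set.mem_Ici.2 (by norm_num)) (Set.mem_Ici.2 hx) h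
    refine lt_of_le_of_lt ?_ (hle.trans_lt soninJ1_three_halves_lt)
    have : 0 < x ^ 2 - 3 / 4 := by nlinarith
    exact le_add_of_nonneg_right (by positivity)

/-- For all `x ≥ 1`, `|J₁(x)| < 1/√x`. -/
theorem abs_besselJ1_lt (x : ℝ) (hx : 1 ≤ x) : |besselJ1 x| < 1 / Real.sqrt x := by
  have hx0 : 0 < x := by linarith
  rw [lt_div_iff₀ (Real.sqrt_pos.2 hx0)]
  refine lt_of_pow_lt_pow_left₀ 2 zero_le_one ?_
  rw [mul_pow, sq_abs, Real.sq_sqrt hx0.le, one_pow, mul_comm]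
  exact mul_besselJ1_sq_lt_one hx
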